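/- Let G be a groupoid and S a family of steps on G, and suppose G is S-terminating and S-confluent. Let W be the wide subgroupoid of G generated by S (whose morphisms are the S-zigzags); then W is rigid, and the explicit quotient category G/∼_W (described in the context) is isomorphic, as a category, to the full subcategory of G whose objects are the S-normal objects. -/

import Mathlib

open CategoryTheory

universe v u

universe u' v' u₁ u₂ v₁ v₂

variable {G : Type u} [Groupoid.{v} G]

/-- `S`-paths: the smallest family of morphisms of `G` containing the steps of `S` and all
identities and closed under composition. -/
inductive IsPath (S : ∀ ⦃x y : G⦄, (x ⟶ y) → Prop) : ∀ ⦃x y : G⦄, (x ⟶ y) → Prop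
  | of {x y : G} {f : x ⟶ y} : S f → IsPath S f
  | id (x : G) : IsPath S (𝟙 x)
  | comp {x y z : G} {f : x ⟶ y} {g : y ⟶ z} : IsPath S f → IsPath S g → IsPath S (f ≫ g)

/-- `S`-zigzags: the smallest family of morphisms of `G` containing the steps of `S` and all
identities and closed under composition and inverses (the wide subgroupoid generated
by `S`). -/
inductive IsZigzag (S : ∀ ⦃x y : G⦄, (x ⟶ y) → Prop) : ∀ ⦃x y : G⦄, (x ⟶ y) → Prop
  | of {x y : G} {f : x ⟶ y} : S f → IsZigzag S f
  | id (x : G) : IsZigzag S (𝟙 x)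
  | comp {x y z : G} {f : x ⟶ y} {g : y ⟶ z} : IsZigzag S f → IsZigzag S g → IsZigzag S (f ≫ g)
  | inv {x y : G} {f : x ⟶ y} : IsZigzag S f → IsZigzag S (Groupoid.inv f)

/-- `G` is `S`-terminating: the relation relating `y` to `x` whenever there is a step
`x ⟶ y` is well-founded (no infinite sequence of steps). -/
def Terminating (S : ∀ ⦃x y : G⦄, (x ⟶ y) → Prop) : Prop :=
  WellFounded (fun y x : G => ∃ f : x ⟶ y, S f)

/-- `G` is locally `S`-confluent: any two steps with the same source can be closed by a
pair of cofinal `S`-paths making the square commute in `G`. -/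
def LocallyConfluent (S : ∀ ⦃x y : G⦄, (x ⟶ y) → Prop) : Prop :=
  ∀ ⦃x y₁ y₂ : G⦄ (a : x ⟶ y₁) (b : x ⟶ y₂), S a → S b →
    ∃ (z : G) (q₁ : y₁ ⟶ z) (q₂ : y₂ ⟶ z), IsPath S q₁ ∧ IsPath S q₂ ∧ a ≫ q₁ = b ≫ q₂

/-- `G` is `S`-confluent: any two `S`-paths with the same source can be closed by a pair of
cofinal `S`-paths making the square commute in `G`. -/
def Confluent (S : ∀ ⦃x y : G⦄, (x ⟶ y) → Prop) : Prop :=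
  ∀ ⦃x y₁ y₂ : G⦄ (p₁ : x ⟶ y₁) (p₂ : x ⟶ y₂), IsPath S p₁ → IsPath S p₂ →
    ∃ (z : G) (q₁ : y₁ ⟶ z) (q₂ : y₂ ⟶ z), IsPath S q₁ ∧ IsPath S q₂ ∧ p₁ ≫ q₁ = p₂ ≫ q₂

/-- An object is `S`-normal when no step has it as source. -/
def SNormal (S : ∀ ⦃x y : G⦄, (x ⟶ y) → Prop) (x : G) : Prop :=
  ∀ ⦃y : G⦄ (f : x ⟶ y), ¬ S f

/-- `G` is weakly `S`-normalizing: every object admits an `S`-path to an `S`-normal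
object. -/
def WeaklyNormalizing (S : ∀ ⦃x y : G⦄, (x ⟶ y) → Prop) : Prop :=
  ∀ x : G, ∃ (y : G) (p : x ⟶ y), IsPath S p ∧ SNormal S y

section WideSubgroupoids

/-- A wide subgroupoid of a category `C`: a family of morphisms of `C`, all of which are
isomorphisms, containing all identities and closed under composition and inverses. -/
structure WideSubgroupoid (C : Type u) [Category.{v} C] where
  /-- membership of a morphism in the wide subgroupoid -/
  mem : ∀ ⦃x y : C⦄, (x ⟶ y) → Prop
  id_mem : ∀ x : C, mem (𝟙 x)
  comp_mem : ∀ ⦃x y z : C⦄ ⦃f : x ⟶ y⦄ ⦃g : y ⟶ z⦄, mem f → mem g → mem (f ≫ g)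
  is_iso : ∀ ⦃x y : C⦄ ⦃f : x ⟶ y⦄, mem f → IsIso f
  inv_mem : ∀ ⦃x y : C⦄ ⦃f : x ⟶ y⦄ ⦃g : y ⟶ x⦄, mem f → f ≫ g = 𝟙 x → mem g

variable {C : Type u} [Category.{v} C]

/-- A wide subgroupoid is rigid when any two parallel morphisms belonging to it are
equal. -/
def WideSubgroupoid.Rigid (W : WideSubgroupoid C) : Prop :=
  ∀ ⦃x y : C⦄ ⦃f g : x ⟶ y⦄, W.mem f → W.mem g → f = g

/-- A functor is `W`-strict when it sends every morphism of `W` to an identity morphism. -/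
def WideSubgroupoid.IsStrict (W : WideSubgroupoid C) {D : Type u'} [Category.{v'} D]
    (F : C ⥤ D) : Prop :=
  ∀ ⦃x y : C⦄ ⦃f : x ⟶ y⦄, W.mem f → ∃ h : F.obj x = F.obj y, F.map f = eqToHom h

/-- The relation on objects of `C` identifying `x` and `y` whenever some morphism of `W`
goes from `x` to `y`. -/
def WideSubgroupoid.ObjRel (W : WideSubgroupoid C) (x y : C) : Prop :=
  ∃ f : x ⟶ y, W.mem f

/-- The type of all morphisms of `C`. -/
def Mor (C : Type u) [Category.{v} C] : Type max u v :=
  Σ x : C, Σ y : C, x ⟶ y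

/-- The relation on morphisms of `C` identifying `f : x ⟶ y` and `f' : x' ⟶ y'` whenever
there are `v : x ⟶ x'` and `w : y ⟶ y'` in `W` with `f ≫ w = v ≫ f'`. -/
def WideSubgroupoid.MorRel (W : WideSubgroupoid C) (m m' : Mor C) : Prop :=
  ∃ (v : m.1 ⟶ m'.1) (w : m.2.1 ⟶ m'.2.1), W.mem v ∧ W.mem w ∧ m.2.2 ≫ w = v ≫ m'.2.2

/-- The data exhibiting the explicit quotient category `C/∼_W` of a category `C` by a rigid
wide subgroupoid `W`: a category structure on the type of equivalence classes of objects,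
together with the canonical functor `π` sending an object to its class, such that morphisms
`[x] ⟶ [y]` are exactly the equivalence classes of morphisms of `C` (fields `full` and
`hom_eq_iff`), composition is given by `[g] ∘ [f] = [f ≫ w_{y,y'} ≫ g]` (field `comp_eq`),
the functor `π` is `W`-strict, and every `W`-strict functor out of `C` factors uniquely
through `π`. -/
structure WideSubgroupoid.ExplicitQuotient (W : WideSubgroupoid C) where
  [instCat : Category.{max u v} (Quot W.ObjRel)]
  /-- the canonical quotient functor -/
  π : C ⥤ Quot W.ObjRel
  /-- on objects, `π` is the canonical quotient map onto equivalence classes -/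
  obj_eq : ∀ x : C, π.obj x = Quot.mk W.ObjRel x
  /-- two objects have the same class iff they are related -/
  obj_eq_iff : ∀ x y : C, π.obj x = π.obj y ↔ W.ObjRel x y
  /-- every morphism between classes is the class of a morphism of `C` -/
  full : ∀ ⦃x y : C⦄ (g : π.obj x ⟶ π.obj y), ∃ f : x ⟶ y, π.map f = g
  /-- two morphisms of `C` have the same class (modulo the identification of their
  endpoints) iff they are related by `∼_W` -/
  hom_eq_iff : ∀ ⦃x y x' y' : C⦄ (f : x ⟶ y) (f' : x' ⟶ y')
      (hx : π.obj x = π.obj x') (hy : π.obj y = π.obj y'),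
      (π.map f ≫ eqToHom hy = eqToHom hx ≫ π.map f') ↔ W.MorRel ⟨x, y, f⟩ ⟨x', y', f'⟩
  /-- composition in the quotient is computed by `[g] ∘ [f] = [f ≫ w_{y,y'} ≫ g]` -/
  comp_eq : ∀ ⦃x y y' z : C⦄ (f : x ⟶ y) (w : y ⟶ y') (g : y' ⟶ z), W.mem w →
      ∀ h : π.obj y = π.obj y',
      π.map (f ≫ w ≫ g) = π.map f ≫ eqToHom h ≫ π.map g
  /-- the canonical functor is `W`-strict -/
  strict : W.IsStrict π
  /-- every `W`-strict functor factors uniquely through `π` -/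
  universal : ∀ {D : Type max u v} [Category.{max u v} D] (F : C ⥤ D),
      W.IsStrict F → ∃! F' : Quot W.ObjRel ⥤ D, π ⋙ F' = F

/-- Two categories are isomorphic when there are functors between them composing to the
identity functors on the nose. -/
def CatIso (A : Type u₁) (B : Type u₂) [Category.{v₁} A] [Category.{v₂} B] : Prop :=
  ∃ (F : A ⥤ B) (F' : B ⥤ A), F ⋙ F' = 𝟭 A ∧ F' ⋙ F = 𝟭 B

end WideSubgroupoids

/-- The wide subgroupoid of a groupoid `G` generated by a family of steps `S`: its
morphisms are the `S`-zigzags. -/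
def zigzagSubgroupoid (S : ∀ ⦃x y : G⦄, (x ⟶ y) → Prop) : WideSubgroupoid G where
  mem := IsZigzag S
  id_mem := IsZigzag.id
  comp_mem := by intro x y z f g hf hg; exact hf.comp hg
  is_iso := by intro x y f _; exact ⟨Groupoid.inv f, Groupoid.comp_inv f, Groupoid.inv_comp f⟩
  inv_mem := by
    intro x y f g hf hfg
    have hg : g = Groupoid.inv f := by
      calc g = (Groupoid.inv f ≫ f) ≫ g := by rw [Groupoid.inv_comp, Category.id_comp]
      _ = Groupoid.inv f ≫ (f ≫ g) := by rw [Category.assoc]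
      _ = Groupoid.inv f := by rw [hfg, Category.comp_id]
    rw [hg]
    exact hf.inv

section NormalForms

variable {S : ∀ ⦃x y : G⦄, (x ⟶ y) → Prop}

theorem IsPath.isZigzag {x y : G} {f : x ⟶ y} (hf : IsPath S f) : IsZigzag S f := by
  induction hf with
  | of h => exact .of h
  | id x => exact .id x
  | comp _ _ ih₁ ih₂ => exact ih₁.comp ih₂

theorem IsPath.eq_eqToHom {x y : G} {f : x ⟶ y} (hf : IsPath S f) (hx : SNormal S x) :
    ∃ h : x = y, f = eqToHom h := by
  induction hf with
  | of h => exact (hx _ h).elim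
  | id x => exact ⟨rfl, rfl⟩
  | comp _ _ ih₁ ih₂ =>
    obtain ⟨rfl, rfl⟩ := ih₁ hx
    obtain ⟨rfl, rfl⟩ := ih₂ hx
    exact ⟨rfl, by simp⟩

theorem Terminating.weaklyNormalizing (h : Terminating S) : WeaklyNormalizing S := by
  intro x
  induction x using WellFounded.induction h with
  | _ x ih =>
    by_cases hx : SNormal S x
    · exact ⟨x, 𝟙 x, .id x, hx⟩
    · simp only [SNormal, not_forall, not_not] at hx
      obtain ⟨y, f, hf⟩ := hx
      obtain ⟨z, p, hp, hz⟩ := ih y ⟨f, hf⟩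
      exact ⟨z, f ≫ p, (IsPath.of hf).comp hp, hz⟩

/-- Under confluence, two paths with the same source and normal targets are equal. -/
theorem Confluent.path_unique (hc : Confluent S) {x a b : G} {p : x ⟶ a} {q : x ⟶ b}
    (hp : IsPath S p) (hq : IsPath S q) (ha : SNormal S a) (hb : SNormal S b) :
    ∃ h : a = b, p ≫ eqToHom h = q := by
  obtain ⟨z, p', q', hp', hq', e⟩ := hc p q hp hq
  obtain ⟨rfl, rfl⟩ := hp'.eq_eqToHom ha
  obtain ⟨rfl, rfl⟩ := hq'.eq_eqToHom hb
  exact ⟨rfl, by simpa using e⟩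

/-- Normalizing paths commute with zigzags. -/
theorem Confluent.zigzag_comp (hc : Confluent S) (hw : WeaklyNormalizing S) {x y : G}
    {f : x ⟶ y} (hf : IsZigzag S f) {a b : G} {p : x ⟶ a} {q : y ⟶ b}
    (hp : IsPath S p) (hq : IsPath S q) (ha : SNormal S a) (hb : SNormal S b) :
    ∃ h : a = b, p ≫ eqToHom h = f ≫ q := by
  induction hf generalizing a b with
  | of h => exact hc.path_unique hp ((IsPath.of h).comp hq) ha hb
  | id x => simpa using hc.path_unique hp hq ha hb
  | @comp _ y _ f g _ _ ih₁ ih₂ =>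
    obtain ⟨c, r, hr, hcn⟩ := hw y
    obtain ⟨rfl, e₁⟩ := ih₁ hp hr ha hcn
    obtain ⟨rfl, e₂⟩ := ih₂ hr hq hcn hb
    refine ⟨rfl, ?_⟩
    simp only [eqToHom_refl, Category.comp_id] at e₁ e₂
    simp [e₁, e₂]
  | inv _ ih =>
    obtain ⟨rfl, e⟩ := ih hq hp hb ha
    refine ⟨rfl, ?_⟩
    simp only [eqToHom_refl, Category.comp_id] at e
    simp [e]

theorem Confluent.rigid (hc : Confluent S) (hw : WeaklyNormalizing S) :
    (zigzagSubgroupoid S).Rigid := by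
  intro x y f g hf hg
  obtain ⟨a, p, hp, ha⟩ := hw x
  obtain ⟨b, q, hq, hb⟩ := hw y
  obtain ⟨_, e₁⟩ := hc.zigzag_comp hw hf hp hq ha hb
  obtain ⟨_, e₂⟩ := hc.zigzag_comp hw hg hp hq ha hb
  exact (cancel_mono q).1 (e₁.symm.trans e₂)

end NormalForms

namespace WideSubgroupoid

/-- A coherent choice of a representative for every class of objects modulo a wide
subgroupoid `W`, together with morphisms of `W` to the representatives which are natural
with respect to the morphisms of `W`. -/
structure Representatives (W : WideSubgroupoid G) where
  /-- the representative of the class of an object -/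
  rep : G → G
  /-- the morphism from an object to its representative -/
  toRep : ∀ x, x ⟶ rep x
  toRep_mem : ∀ x, W.mem (toRep x)
  natural : ∀ ⦃x y : G⦄ ⦃f : x ⟶ y⦄, W.mem f →
    ∃ h : rep x = rep y, toRep x ≫ eqToHom h = f ≫ toRep y

theorem mem_eqToHom (W : WideSubgroupoid G) {x y : G} (h : x = y) : W.mem (eqToHom h) := by
  subst h
  exact W.id_mem x

theorem mem_groupoidInv (W : WideSubgroupoid G) {x y : G} {f : x ⟶ y} (hf : W.mem f) :
    W.mem (Groupoid.inv f) :=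
  W.inv_mem hf (Groupoid.comp_inv f)

namespace Representatives

variable {W : WideSubgroupoid G} (R : W.Representatives)

/-- The representative of a class of objects. -/
def quotRep : Quot W.ObjRel → G :=
  Quot.lift R.rep fun _ _ ⟨_, hf⟩ => (R.natural hf).1

/-- The category structure on classes of objects in which morphisms are the morphisms
between representatives. -/
@[reducible]
def quotCategory : Category.{max u v} (Quot W.ObjRel) where
  Hom q q' := ULift.{max u v} (R.quotRep q ⟶ R.quotRep q')
  id q := ⟨𝟙 _⟩
  comp f g := ⟨f.down ≫ g.down⟩

theorem comp_down {q q' q'' : Quot W.ObjRel} :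
    letI := R.quotCategory
    ∀ (f : q ⟶ q') (g : q' ⟶ q''), (f ≫ g).down = f.down ≫ g.down := fun _ _ => rfl

theorem eqToHom_down {q q' : Quot W.ObjRel} (h : q = q') :
    letI := R.quotCategory
    (eqToHom h).down = eqToHom (congrArg R.quotRep h) := by
  subst h
  rfl

theorem eqToHom_comp_comp_eqToHom_down {p q q' p' : Quot W.ObjRel} (h : p = q) (h' : q' = p') :
    letI := R.quotCategory
    ∀ g : q ⟶ q', (eqToHom h ≫ g ≫ eqToHom h').down =
      eqToHom (congrArg R.quotRep h) ≫ g.down ≫ eqToHom (congrArg R.quotRep h') := by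
  let := R.quotCategory
  intro g
  rw [comp_down, comp_down, eqToHom_down, eqToHom_down]

/-- The canonical functor to the category of classes of objects. -/
def quotFunctor :
    letI := R.quotCategory
    G ⥤ Quot W.ObjRel :=
  letI := R.quotCategory
  { obj := Quot.mk W.ObjRel
    map := fun {x y} f => ⟨Groupoid.inv (R.toRep x) ≫ f ≫ R.toRep y⟩
    map_id := fun x => ULift.ext _ _ (by
      change Groupoid.inv (R.toRep x) ≫ 𝟙 x ≫ R.toRep x = 𝟙 (R.rep x)
      simp)
    map_comp := fun {x y z} f g => ULift.ext _ _ (by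
      change Groupoid.inv (R.toRep x) ≫ (f ≫ g) ≫ R.toRep z =
        (Groupoid.inv (R.toRep x) ≫ f ≫ R.toRep y) ≫
          Groupoid.inv (R.toRep y) ≫ g ≫ R.toRep z
      simp) }

theorem quotFunctor_isStrict :
    letI := R.quotCategory
    W.IsStrict R.quotFunctor := by
  let := R.quotCategory
  intro x y f hf
  obtain ⟨h, e⟩ := R.natural hf
  have hxy : R.quotFunctor.obj x = R.quotFunctor.obj y := Quot.sound ⟨f, hf⟩
  refine ⟨hxy, ULift.ext _ _ ?_⟩
  refine Eq.trans ?_ (R.eqToHom_down hxy).symm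
  change Groupoid.inv (R.toRep x) ≫ f ≫ R.toRep y = eqToHom h
  rw [← e]
  simp

theorem quotFunctor_map_surjective {x y : G} :
    letI := R.quotCategory
    ∀ g : R.quotFunctor.obj x ⟶ R.quotFunctor.obj y, ∃ f : x ⟶ y, R.quotFunctor.map f = g := by
  let := R.quotCategory
  intro g
  let g' : R.rep x ⟶ R.rep y := g.down
  refine ⟨R.toRep x ≫ g' ≫ Groupoid.inv (R.toRep y), ULift.ext _ _ ?_⟩
  change Groupoid.inv (R.toRep x) ≫ (R.toRep x ≫ g' ≫ Groupoid.inv (R.toRep y)) ≫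
    R.toRep y = g'
  simp

theorem objRel_of_rep_eq {x y : G} (h : R.rep x = R.rep y) : W.ObjRel x y :=
  ⟨R.toRep x ≫ eqToHom h ≫ Groupoid.inv (R.toRep y),
    W.comp_mem (R.toRep_mem x)
      (W.comp_mem (W.mem_eqToHom h) (W.mem_groupoidInv (R.toRep_mem y)))⟩

theorem quotFunctor_map_comp_eqToHom_iff {x y x' y' : G} (f : x ⟶ y) (f' : x' ⟶ y') :
    letI := R.quotCategory
    ∀ (hx : R.quotFunctor.obj x = R.quotFunctor.obj x')
      (hy : R.quotFunctor.obj y = R.quotFunctor.obj y'),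
      R.quotFunctor.map f ≫ eqToHom hy = eqToHom hx ≫ R.quotFunctor.map f' ↔
        W.MorRel ⟨x, y, f⟩ ⟨x', y', f'⟩ := by
  let := R.quotCategory
  intro hx hy
  have hx' : R.rep x = R.rep x' := congrArg R.quotRep hx
  have hy' : R.rep y = R.rep y' := congrArg R.quotRep hy
  have key : R.quotFunctor.map f ≫ eqToHom hy = eqToHom hx ≫ R.quotFunctor.map f' ↔
      (Groupoid.inv (R.toRep x) ≫ f ≫ R.toRep y) ≫ eqToHom hy' =
        eqToHom hx' ≫ Groupoid.inv (R.toRep x') ≫ f' ≫ R.toRep y' := by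
    rw [← ULift.down_inj, comp_down, comp_down, eqToHom_down, eqToHom_down]
    rfl
  rw [key]
  constructor
  · intro e
    refine ⟨R.toRep x ≫ eqToHom hx' ≫ Groupoid.inv (R.toRep x'),
      R.toRep y ≫ eqToHom hy' ≫ Groupoid.inv (R.toRep y'),
      W.comp_mem (R.toRep_mem x)
        (W.comp_mem (W.mem_eqToHom _) (W.mem_groupoidInv (R.toRep_mem x'))),
      W.comp_mem (R.toRep_mem y)
        (W.comp_mem (W.mem_eqToHom _) (W.mem_groupoidInv (R.toRep_mem y'))), ?_⟩
    have := congrArg (fun t => R.toRep x ≫ t ≫ Groupoid.inv (R.toRep y')) e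
    simpa using this
  · rintro ⟨v, w, hv, hw, e⟩
    dsimp only at v w hv hw e
    obtain ⟨_, ev⟩ := R.natural hv
    obtain ⟨_, ew⟩ := R.natural hw
    have ev' : eqToHom hx' = Groupoid.inv (R.toRep x) ≫ v ≫ R.toRep x' := by
      rw [← ev]
      simp
    simp only [Category.assoc, ew, ev', reassoc_of% e]
    simp

/-- A functor out of the quotient is determined by its composition with the canonical
functor. -/
theorem quotFunctor_comp_injective {D : Type u'} [Category.{v'} D] :
    letI := R.quotCategory
    ∀ F F' : Quot W.ObjRel ⥤ D, R.quotFunctor ⋙ F = R.quotFunctor ⋙ F' → F = F' := by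
  let := R.quotCategory
  intro F F' h
  refine CategoryTheory.Functor.hext (fun q => ?_) fun q q' g => ?_
  · obtain ⟨x, rfl⟩ := Quot.exists_rep q
    exact Functor.congr_obj h x
  · obtain ⟨x, rfl⟩ := Quot.exists_rep q
    obtain ⟨y, rfl⟩ := Quot.exists_rep q'
    obtain ⟨f, rfl⟩ := R.quotFunctor_map_surjective g
    exact Functor.hcongr_hom h f

/-- The functor induced on the quotient by a functor out of `G`. -/
def quotLift {D : Type u'} [Category.{v'} D] (F : G ⥤ D) :
    letI := R.quotCategory
    Quot W.ObjRel ⥤ D :=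
  letI := R.quotCategory
  { obj := fun q => F.obj (R.quotRep q)
    map := fun f => F.map f.down
    map_id := fun _ => F.map_id _
    map_comp := fun _ _ => F.map_comp _ _ }

theorem quotFunctor_comp_quotLift {D : Type u'} [Category.{v'} D] (F : G ⥤ D)
    (hF : W.IsStrict F) :
    letI := R.quotCategory
    R.quotFunctor ⋙ R.quotLift F = F := by
  let := R.quotCategory
  choose h e using fun x => hF (R.toRep_mem x)
  refine CategoryTheory.Functor.ext (fun x => (h x).symm) fun x y f => ?_
  have e' : F.map (Groupoid.inv (R.toRep x)) = eqToHom (h x).symm := by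
    rw [← cancel_epi (F.map (R.toRep x)), ← F.map_comp, Groupoid.comp_inv, e]
    simp
  change F.map (Groupoid.inv (R.toRep x) ≫ f ≫ R.toRep y) = _
  rw [F.map_comp, F.map_comp, e, e']
  rfl

/-- The explicit quotient category attached to a coherent choice of representatives. -/
def explicitQuotient : W.ExplicitQuotient :=
  letI := R.quotCategory
  { instCat := R.quotCategory
    π := R.quotFunctor
    obj_eq := fun _ => rfl
    obj_eq_iff := fun _ _ =>
      ⟨fun h => R.objRel_of_rep_eq (congrArg R.quotRep h), fun h => Quot.sound h⟩
    full := fun _ _ g => R.quotFunctor_map_surjective g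
    hom_eq_iff := fun _ _ _ _ f f' => R.quotFunctor_map_comp_eqToHom_iff f f'
    comp_eq := fun _ _ _ _ f w g hw h => by
      obtain ⟨_, e⟩ := R.quotFunctor_isStrict hw
      rw [Functor.map_comp, Functor.map_comp, e]
    strict := R.quotFunctor_isStrict
    universal := fun F hF =>
      ⟨R.quotLift F, R.quotFunctor_comp_quotLift F hF, fun _ h =>
        R.quotFunctor_comp_injective _ _ (h.trans (R.quotFunctor_comp_quotLift F hF).symm)⟩ }

/-- If representatives satisfy `P` and objects satisfying `P` are their own representatives,
then the quotient is isomorphic to the full subcategory on the objects satisfying `P`. -/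
theorem catIso_fullSubcategory {P : ObjectProperty G} (hP : ∀ x, P (R.rep x))
    (hR : ∀ x, P x → ∃ h : x = R.rep x, R.toRep x = eqToHom h) :
    @CatIso (Quot W.ObjRel) P.FullSubcategory R.explicitQuotient.instCat inferInstance := by
  let := R.quotCategory
  have hP' : ∀ q, P (R.quotRep q) := Quot.ind hP
  have hinv : ∀ x (h : x = R.rep x), R.toRep x = eqToHom h →
      Groupoid.inv (R.toRep x) = eqToHom h.symm := by
    intro x h e
    rw [← cancel_epi (R.toRep x), Groupoid.comp_inv, e]
    simp
  choose h e using hR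
  have hq : ∀ q, Quot.mk W.ObjRel (R.quotRep q) = q := by
    intro q
    obtain ⟨x, rfl⟩ := Quot.exists_rep q
    exact (Quot.sound ⟨R.toRep x, R.toRep_mem x⟩).symm
  let F : Quot W.ObjRel ⥤ P.FullSubcategory :=
    P.lift (R.quotLift (𝟭 G)) hP'
  refine ⟨F, P.ι ⋙ R.quotFunctor, ?_, ?_⟩
  · refine CategoryTheory.Functor.ext hq fun q q' g => ULift.ext _ _ ?_
    refine Eq.trans ?_ (R.eqToHom_comp_comp_eqToHom_down (hq q) (hq q').symm g).symm
    change Groupoid.inv (R.toRep (R.quotRep q)) ≫ g.down ≫ R.toRep (R.quotRep q') = _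
    rw [e _ (hP' q'), hinv _ _ (e _ (hP' q))]
    rfl
  · refine CategoryTheory.Functor.ext (fun x => ObjectProperty.FullSubcategory.ext (h x.1 x.2).symm)
      fun x y f => ?_
    apply P.ι.map_injective
    rw [Functor.map_comp, Functor.map_comp, eqToHom_map, eqToHom_map]
    change Groupoid.inv (R.toRep x.1) ≫ f.hom ≫ R.toRep y.1 = _
    rw [e _ y.2, hinv _ _ (e _ x.2)]
    rfl

end Representatives

end WideSubgroupoid

/-- The normal forms of a confluent and weakly normalizing groupoid, as representatives of
the classes of objects modulo zigzags. -/
noncomputable def Confluent.representatives {S : ∀ ⦃x y : G⦄, (x ⟶ y) → Prop}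
    (hc : Confluent S) (hw : WeaklyNormalizing S) : (zigzagSubgroupoid S).Representatives where
  rep x := (hw x).choose
  toRep x := (hw x).choose_spec.choose
  toRep_mem x := (hw x).choose_spec.choose_spec.1.isZigzag
  natural x y _ hf := hc.zigzag_comp hw hf (hw x).choose_spec.choose_spec.1
    (hw y).choose_spec.choose_spec.1 (hw x).choose_spec.choose_spec.2
    (hw y).choose_spec.choose_spec.2

/-- If `G` is `S`-terminating and `S`-confluent, then the wide subgroupoid `W` generated by
`S` is rigid, and the explicit quotient category `G/∼_W` is isomorphic, as a category, to
the full subcategory of `G` on the `S`-normal objects. -/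
theorem rigid_and_quotient_iso_normal_forms (S : ∀ ⦃x y : G⦄, (x ⟶ y) → Prop)
    (hterm : Terminating S) (hc : Confluent S) :
    (zigzagSubgroupoid S).Rigid ∧
      ∃ E : (zigzagSubgroupoid S).ExplicitQuotient,
        @CatIso (Quot (zigzagSubgroupoid S).ObjRel) (ObjectProperty.FullSubcategory (SNormal S))
          E.instCat inferInstance := by
  have hw := hterm.weaklyNormalizing
  refine ⟨hc.rigid hw, (hc.representatives hw).explicitQuotient,
    WideSubgroupoid.Representatives.catIso_fullSubcategory _
      (fun x => (hw x).choose_spec.choose_spec.2) fun x hx => ?_⟩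
  obtain ⟨h, e⟩ := (hw x).choose_spec.choose_spec.1.eq_eqToHom hx
  exact ⟨h, e⟩
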